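/- Let (x, p) be a mechanism that is truthful for quasi-linear buyers. Assume that for each agent i the maps α ↦ v_i(x(α_1 v_1, …, α_n v_n)) and α ↦ p_i(α_1 v_1, …, α_n v_n) are continuous on [0,1]^n, and that for each i and each fixed α_{−i}, the map α_i ↦ p_i(α_1 v_1, …, α_n v_n) is strictly increasing on [0,1]. Then there exists a profile α ∈ (0,1]^n such that for every agent i: (a) the bid α_i·v_i maximizes U_i(·, (α_j v_j)_{j≠i}) over all bids b_i ∈ V, and (b) α_i·C_i′(p_i(α_1 v_1, …, α_n v_n)) = 1 (α_i is ROI-optimal). In particular, (α_i v_i)_{i=1}^n is a pure Nash equilibrium in ROI-optimal uniform scaling strategies. -/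

import Mathlib

section Brouwer

open MeasureTheory Polynomial Set Filter Topology

/-- The value at `1` of a polynomial of bounded degree is a fixed linear combination of its values
at nodes that can be chosen arbitrarily close to `0`. -/
lemma Polynomial.exists_eval_one_eq_sum (N : ℕ) {ε : ℝ} (hε : 0 < ε) :
    ∃ c t : ℕ → ℝ, (∀ i ∈ Finset.range (N + 1), 0 ≤ t i ∧ t i < ε) ∧
      ∀ p : ℝ[X], p.natDegree ≤ N →
        p.eval 1 = ∑ i ∈ Finset.range (N + 1), c i * p.eval (t i) := by
  have hN : (0 : ℝ) < N + 1 := by positivity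
  let t : ℕ → ℝ := fun i => ε * (i / (N + 1))
  refine ⟨fun i => (Lagrange.basis (Finset.range (N + 1)) t i).eval 1, t, fun i hi => ?_,
    fun p hp => ?_⟩
  · refine ⟨by positivity, ?_⟩
    have hi' : (i : ℝ) < N + 1 := by exact_mod_cast Finset.mem_range.1 hi
    exact mul_lt_of_lt_one_right hε ((div_lt_one hN).2 hi')
  · have ht : Set.InjOn t (Finset.range (N + 1)) := by
      intro i _ j _ hij
      have := mul_left_cancel₀ hε.ne' hij
      rw [div_left_inj' hN.ne'] at this
      exact_mod_cast this
    have hdeg : p.degree < (Finset.range (N + 1)).card := by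
      rw [Finset.card_range]
      exact degree_le_natDegree.trans_lt (by exact_mod_cast Nat.lt_succ_of_le hp)
    conv_lhs => rw [Lagrange.eq_interpolate ht hdeg]
    simp [Lagrange.interpolate_apply, eval_finsetSum, mul_comm]

/-- `t ↦ det (1 + t M)` is a polynomial of degree at most the size of `M`. -/
lemma Matrix.exists_polynomial_eval_eq_det_one_add_smul {m : Type*} [Fintype m] [DecidableEq m]
    (M : Matrix m m ℝ) :
    ∃ p : ℝ[X], p.natDegree ≤ Fintype.card m ∧ ∀ t : ℝ, p.eval t = (1 + t • M).det := by
  refine ⟨((X : ℝ[X]) • M.map C + (1 : Matrix m m ℝ).map C).det,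
    natDegree_det_X_add_C_le M 1, fun t => ?_⟩
  rw [← coe_evalRingHom, RingHom.map_det]
  congr 1
  ext i j
  rcases eq_or_ne i j with rfl | h
  · simp only [RingHom.mapMatrix_apply, Matrix.map_apply, Matrix.add_apply, Matrix.smul_apply,
      Matrix.one_apply_eq, smul_eq_mul, coe_evalRingHom, eval_add, eval_mul, eval_X, eval_C]
    ring
  · simp only [RingHom.mapMatrix_apply, Matrix.map_apply, Matrix.add_apply, Matrix.smul_apply,
      Matrix.one_apply_ne h, smul_eq_mul, coe_evalRingHom, eval_add, eval_mul, eval_X, eval_C]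
    ring

section FixedPoint

variable {E : Type*} [NormedAddCommGroup E] [InnerProductSpace ℝ E] [FiniteDimensional ℝ E]

/-- `t ↦ det (1 + t A)` is a polynomial of degree at most the dimension. -/
lemma ContinuousLinearMap.exists_polynomial_eval_eq_det_one_add_smul (A : E →L[ℝ] E) :
    ∃ p : ℝ[X], p.natDegree ≤ Module.finrank ℝ E ∧
      ∀ t : ℝ, p.eval t = (1 + t • A).det := by
  obtain ⟨p, hp, hpe⟩ := Matrix.exists_polynomial_eval_eq_det_one_add_smul
    (LinearMap.toMatrix (Module.finBasis ℝ E) (Module.finBasis ℝ E) (A : E →ₗ[ℝ] E))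
  refine ⟨p, by simpa using hp, fun t => ?_⟩
  have h1 : ((1 + t • A : E →L[ℝ] E) : E →ₗ[ℝ] E) = LinearMap.id + t • (A : E →ₗ[ℝ] E) := rfl
  rw [hpe, ContinuousLinearMap.det, ← LinearMap.det_toMatrix (Module.finBasis ℝ E), h1, map_add,
    map_smul, LinearMap.toMatrix_id]

/-- Small multiples of a compactly supported `C¹` map perturb the identity to an
orientation-preserving bijection. -/
lemma ContDiff.exists_bijective_id_add_smul {g : E → E} (hg : ContDiff ℝ 1 g)
    (hs : HasCompactSupport g) :
    ∃ ε > 0, ∀ t : ℝ, 0 ≤ t → t < ε → Function.Bijective (fun x => x + t • g x) ∧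
      ∀ x, 0 < (1 + t • fderiv ℝ g x).det := by
  obtain ⟨K, hK⟩ := ContDiff.lipschitzWith_of_hasCompactSupport hs hg one_ne_zero
  have hdet : ∀ᶠ A : E →L[ℝ] E in 𝓝 1, 0 < A.det := by
    refine ContinuousLinearMap.continuous_det.continuousAt.eventually (lt_mem_nhds ?_)
    simp [ContinuousLinearMap.det]
  obtain ⟨δ, hδ, hball⟩ := Metric.eventually_nhds_iff.1 hdet
  have hK1 : (0 : ℝ) < K + 1 := by positivity
  refine ⟨min 1 δ / (K + 1), by positivity, fun t ht0 ht => ?_⟩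
  have htK : t * K < min 1 δ := by
    rw [lt_div_iff₀ hK1] at ht
    nlinarith
  refine ⟨?_, fun x => hball ?_⟩
  · let c : NNReal := ⟨t, ht0⟩ * K
    have happ : ApproximatesLinearOn (fun x => x + t • g x)
        ((ContinuousLinearEquiv.refl ℝ E : E ≃L[ℝ] E) : E →L[ℝ] E) univ c := by
      intro x _ y _
      have : x + t • g x - (y + t • g y) - (x - y) = t • (g x - g y) := by
        rw [smul_sub]; abel
      simp only [ContinuousLinearEquiv.coe_refl, ContinuousLinearMap.coe_id', id, this]
      rw [norm_smul, Real.norm_of_nonneg ht0]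
      have := hK.dist_le_mul x y
      rw [dist_eq_norm, dist_eq_norm] at this
      calc t * ‖g x - g y‖ ≤ t * (K * ‖x - y‖) := by gcongr
        _ = (c : ℝ) * ‖x - y‖ := (mul_assoc _ _ _).symm
    refine (happ.toHomeomorph _ ?_).bijective
    rcases subsingleton_or_nontrivial E with h | h
    · exact Or.inl h
    · right
      have h1 : ‖((ContinuousLinearEquiv.refl ℝ E).symm : E →L[ℝ] E)‖₊ = 1 := by
        ext; simp
      rw [h1, inv_one, ← NNReal.coe_lt_coe]
      exact htK.trans_le (min_le_left _ _)
  · rw [dist_eq_norm, add_sub_cancel_left, norm_smul, Real.norm_of_nonneg ht0]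
    refine lt_of_le_of_lt ?_ (htK.trans_le (min_le_right _ _))
    gcongr
    exact norm_fderiv_le_of_lipschitz ℝ hK

variable [MeasurableSpace E] [BorelSpace E]

/-- Extrapolation to `t = 1` of the change of variables formula for `x ↦ x + t g(x)`. -/
lemma integral_det_mul_one_sub_norm_sq_pow (μ : Measure E) [μ.IsAddHaarMeasure] {g : E → E}
    (hg : ContDiff ℝ 1 g) (hs : HasCompactSupport g) {B : Set E} (hB : IsCompact B)
    (hgB : ∀ x ∉ B, g x = 0) (r : ℝ) (k : ℕ) :
    ∫ x in B, (1 + fderiv ℝ g x).det * (1 - r * ‖x + g x‖ ^ 2) ^ k ∂μ =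
      ∫ x in B, (1 - r * ‖x‖ ^ 2) ^ k ∂μ := by
  obtain ⟨ε, hε, hbij⟩ := hg.exists_bijective_id_add_smul hs
  obtain ⟨c, t, ht, hsum⟩ :=
    Polynomial.exists_eval_one_eq_sum (Module.finrank ℝ E + 2 * k) hε
  let q : ℝ → E → ℝ := fun s x =>
    (1 + s • fderiv ℝ g x).det * (1 - r * ‖x + s • g x‖ ^ 2) ^ k
  have hq : ∀ x, q 1 x = ∑ i ∈ Finset.range (Module.finrank ℝ E + 2 * k + 1), c i * q (t i) x := by
    intro x
    obtain ⟨p, hp, hpe⟩ := (fderiv ℝ g x).exists_polynomial_eval_eq_det_one_add_smul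
    let u : ℝ[X] := C (1 - r * ‖x‖ ^ 2) - C (2 * r * inner ℝ x (g x)) * X -
      C (r * ‖g x‖ ^ 2) * X ^ 2
    have hu : u.natDegree ≤ 2 := by simp only [u]; compute_degree
    have hue : ∀ s : ℝ, u.eval s = 1 - r * ‖x + s • g x‖ ^ 2 := by
      intro s
      rw [norm_add_sq_real, norm_smul, inner_smul_right, mul_pow, Real.norm_eq_abs, sq_abs]
      simp only [u, eval_sub, eval_mul, eval_C, eval_X, eval_pow]
      ring
    have hdeg : (p * u ^ k).natDegree ≤ Module.finrank ℝ E + 2 * k := by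
      refine natDegree_mul_le.trans (add_le_add hp (natDegree_pow_le.trans ?_))
      rw [mul_comm]
      exact Nat.mul_le_mul_right k hu
    simpa [q, hpe, hue] using hsum _ hdeg
  have hone : 1 = ∑ i ∈ Finset.range (Module.finrank ℝ E + 2 * k + 1), c i := by
    simpa using hsum 1 (by simp)
  have hcont : ∀ s, Continuous (q s) := by
    intro s
    have h1 : Continuous (fderiv ℝ g) := hg.continuous_fderiv one_ne_zero
    have h2 : Continuous g := hg.continuous
    have h3 : Continuous fun x => (1 + s • fderiv ℝ g x).det :=
      ContinuousLinearMap.continuous_det.comp (by fun_prop)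
    exact h3.mul (by fun_prop)
  have hint : ∀ i ∈ Finset.range (Module.finrank ℝ E + 2 * k + 1),
      ∫ x in B, q (t i) x ∂μ = ∫ x in B, (1 - r * ‖x‖ ^ 2) ^ k ∂μ := by
    intro i hi
    obtain ⟨hb, hd⟩ := hbij (t i) (ht i hi).1 (ht i hi).2
    have himage : (fun x => x + t i • g x) '' B = B := by
      have hcompl : (fun x => x + t i • g x) '' Bᶜ = Bᶜ := by
        have : EqOn (fun x => x + t i • g x) id Bᶜ := fun x hx => by simp [hgB x hx]
        rw [this.image_eq, image_id]
      rw [← compl_inj_iff, ← image_compl_eq hb, hcompl]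
    have hderiv : ∀ x ∈ B, HasFDerivWithinAt (fun x => x + t i • g x)
        (1 + t i • fderiv ℝ g x) B x := fun x _ =>
      ((hasFDerivAt_id x).add
        (((hg.differentiable one_ne_zero) x).hasFDerivAt.const_smul (t i))).hasFDerivWithinAt
    have := integral_image_eq_integral_abs_det_fderiv_smul μ hB.measurableSet hderiv
      hb.injective.injOn (fun y => (1 - r * ‖y‖ ^ 2) ^ k)
    rw [himage] at this
    rw [this]
    refine integral_congr_ae (Eventually.of_forall fun x => ?_)
    simp [q, abs_of_pos (hd x)]
  calc ∫ x in B, (1 + fderiv ℝ g x).det * (1 - r * ‖x + g x‖ ^ 2) ^ k ∂μ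
      = ∫ x in B, q 1 x ∂μ := by simp [q]
    _ = ∑ i ∈ Finset.range (Module.finrank ℝ E + 2 * k + 1), c i * ∫ x in B, q (t i) x ∂μ := by
        simp_rw [hq]
        rw [integral_finsetSum _ fun i _ =>
          (((hcont (t i)).const_mul (c i)).continuousOn.integrableOn_compact hB)]
        simp_rw [integral_const_mul]
    _ = ∫ x in B, (1 - r * ‖x‖ ^ 2) ^ k ∂μ := by
        rw [Finset.sum_congr rfl fun i hi => by rw [hint i hi], ← Finset.sum_mul, ← hone, one_mul]

/-- A compactly supported `C¹` perturbation of the identity has a zero. -/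
lemma ContDiff.exists_add_eq_zero {g : E → E} (hg : ContDiff ℝ 1 g) (hs : HasCompactSupport g) :
    ∃ x, x + g x = 0 := by
  by_contra! hne
  let μ : Measure E := Measure.addHaar
  obtain ⟨R, hR, hgR⟩ : ∃ R > 0, ∀ x ∉ Metric.closedBall (0 : E) R, g x = 0 := by
    obtain ⟨R, hR⟩ := hs.isCompact.isBounded.subset_closedBall 0
    refine ⟨max R 1, by positivity, fun x hx => image_eq_zero_of_notMem_tsupport fun h => hx ?_⟩
    exact Metric.closedBall_subset_closedBall (le_max_left _ _) (hR h)
  have hB : IsCompact (Metric.closedBall (0 : E) R) := isCompact_closedBall 0 R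
  have hf : Continuous fun x => x + g x := continuous_id.add hg.continuous
  have hdet : Continuous fun x => (1 + fderiv ℝ g x).det :=
    ContinuousLinearMap.continuous_det.comp
      (continuous_const.add (hg.continuous_fderiv one_ne_zero))
  obtain ⟨δ, hδ, hδR, hδf⟩ : ∃ δ > 0, δ ≤ R ∧
      ∀ x ∈ Metric.closedBall (0 : E) R, δ ≤ ‖x + g x‖ := by
    obtain ⟨x₀, -, hx₀⟩ := hB.exists_isMinOn ⟨0, by simp [hR.le]⟩ hf.norm.continuousOn
    have := norm_pos_iff.2 (hne x₀)
    exact ⟨min ‖x₀ + g x₀‖ R, by positivity, min_le_right _ _,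
      fun x hx => (min_le_left _ _).trans (hx₀ hx)⟩
  obtain ⟨M, hMR, hMf⟩ : ∃ M, R ≤ M ∧ ∀ x ∈ Metric.closedBall (0 : E) R, ‖x + g x‖ ≤ M := by
    obtain ⟨M, hM⟩ := hB.exists_bound_of_continuousOn hf.continuousOn
    exact ⟨max R M, le_max_left _ _, fun x hx => (hM x hx).trans (le_max_right _ _)⟩
  obtain ⟨D, hD⟩ := hB.exists_bound_of_continuousOn hdet.continuousOn
  have hM : 0 < M := hR.trans_le hMR
  let r : ℝ := 1 / M ^ 2
  have hr : 0 < r := by positivity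
  have hrM : ∀ y : E, ‖y‖ ≤ M → 0 ≤ 1 - r * ‖y‖ ^ 2 := by
    intro y hy
    have : r * ‖y‖ ^ 2 ≤ r * M ^ 2 := by gcongr
    have h1 : r * M ^ 2 = 1 := one_div_mul_cancel (by positivity)
    linarith
  let a : ℝ := 1 - r * δ ^ 2
  let b : ℝ := 1 - r * (δ / 2) ^ 2
  have hab : a < b := by
    have : r * (δ / 2) ^ 2 < r * δ ^ 2 := by gcongr; linarith
    simp only [a, b]; linarith
  have ha : 0 ≤ a := by
    have h0 : (0 : E) ∈ Metric.closedBall (0 : E) R := by simp [hR.le]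
    have h1 : r * δ ^ 2 ≤ r * ‖(0 : E) + g 0‖ ^ 2 := by gcongr; exact hδf 0 h0
    have h2 := hrM _ (hMf 0 h0)
    simp only [a]; linarith
  have hb : 0 < b := ha.trans_lt hab
  let m := μ.real (Metric.closedBall (0 : E) (δ / 2))
  have hm : 0 < m := ENNReal.toReal_pos
    (Metric.measure_closedBall_pos μ 0 (by positivity)).ne' measure_closedBall_lt_top.ne
  have hle : ∀ k : ℕ, m * b ^ k ≤ D * a ^ k * μ.real (Metric.closedBall (0 : E) R) := by
    intro k
    have hsub : Metric.closedBall (0 : E) (δ / 2) ⊆ Metric.closedBall (0 : E) R :=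
      Metric.closedBall_subset_closedBall (by linarith)
    have hcont : Continuous fun x : E => (1 - r * ‖x‖ ^ 2) ^ k := by fun_prop
    have hintR := hcont.continuousOn.integrableOn_compact (μ := μ) hB
    calc m * b ^ k = ∫ x in Metric.closedBall (0 : E) (δ / 2), b ^ k ∂μ := by simp [m]
      _ ≤ ∫ x in Metric.closedBall (0 : E) (δ / 2), (1 - r * ‖x‖ ^ 2) ^ k ∂μ := by
        refine setIntegral_mono_on (by simp [measure_closedBall_lt_top])
          (hintR.mono_set hsub) measurableSet_closedBall fun x hx => ?_
        rw [mem_closedBall_zero_iff] at hx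
        simp only [b]
        gcongr
      _ ≤ ∫ x in Metric.closedBall (0 : E) R, (1 - r * ‖x‖ ^ 2) ^ k ∂μ := by
        refine setIntegral_mono_set hintR ?_ (Eventually.of_forall hsub)
        refine (ae_restrict_iff' measurableSet_closedBall).2 (Eventually.of_forall fun x hx => ?_)
        rw [mem_closedBall_zero_iff] at hx
        exact pow_nonneg (hrM x (hx.trans hMR)) k
      _ = ∫ x in Metric.closedBall (0 : E) R,
            (1 + fderiv ℝ g x).det * (1 - r * ‖x + g x‖ ^ 2) ^ k ∂μ :=
        (integral_det_mul_one_sub_norm_sq_pow μ hg hs hB hgR r k).symm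
      _ ≤ ‖∫ x in Metric.closedBall (0 : E) R,
            (1 + fderiv ℝ g x).det * (1 - r * ‖x + g x‖ ^ 2) ^ k ∂μ‖ := Real.le_norm_self _
      _ ≤ D * a ^ k * μ.real (Metric.closedBall (0 : E) R) := by
        refine norm_setIntegral_le_of_norm_le_const measure_closedBall_lt_top fun x hx => ?_
        have h0 := hrM _ (hMf x hx)
        have h1 := hδf x hx
        rw [norm_mul, norm_pow, Real.norm_of_nonneg h0]
        have hD0 : 0 ≤ D := (norm_nonneg _).trans (hD x hx)
        simp only [a]
        gcongr
        exact hD x hx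
  have hlim : Tendsto (fun k : ℕ => D * μ.real (Metric.closedBall (0 : E) R) * (a / b) ^ k)
      atTop (𝓝 0) := by
    simpa using (tendsto_pow_atTop_nhds_zero_of_lt_one (div_nonneg ha hb.le)
      ((div_lt_one hb).2 hab)).const_mul (D * μ.real (Metric.closedBall (0 : E) R))
  obtain ⟨k, hk⟩ := (hlim.eventually (gt_mem_nhds hm)).exists
  have hbk : 0 < b ^ k := by positivity
  rw [div_pow, ← mul_div_assoc, div_lt_iff₀ hbk] at hk
  linarith [hle k]

/-- A compactly supported continuous perturbation of the identity has a zero. -/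
lemma Continuous.exists_add_eq_zero {g : E → E} (hg : Continuous g) (hs : HasCompactSupport g) :
    ∃ x, x + g x = 0 := by
  by_contra! hne
  obtain ⟨δ, hδ, hδf⟩ : ∃ δ > 0, ∀ x, δ ≤ ‖x + g x‖ := by
    have hlim : Tendsto (fun x => ‖x + g x‖) (cocompact E) atTop := by
      refine tendsto_norm_cocompact_atTop.congr' ?_
      filter_upwards [hs.isCompact.compl_mem_cocompact] with x hx
      simp [image_eq_zero_of_notMem_tsupport hx]
    obtain ⟨x₀, hx₀⟩ := (continuous_id.add hg).norm.exists_forall_le hlim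
    exact ⟨_, norm_pos_iff.2 (hne x₀), hx₀⟩
  obtain ⟨f, hf, hfg, hsupp⟩ := hg.exists_contDiff_approx 1 continuous_const fun _ => hδ
  obtain ⟨x, hx⟩ := ContDiff.exists_add_eq_zero (by exact_mod_cast hf) (hs.mono hsupp)
  refine (hfg x).not_ge ((hδf x).trans_eq ?_)
  rw [dist_eq_norm', ← norm_neg, eq_neg_of_add_eq_zero_right hx, norm_neg, sub_neg_eq_add,
    add_comm]

/-- A bounded continuous self-map of a finite-dimensional inner product space has a fixed point. -/
lemma Continuous.exists_isFixedPt_of_norm_le {f : E → E} (hf : Continuous f) {R : ℝ}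
    (hR : ∀ x, ‖f x‖ ≤ R) : ∃ x, Function.IsFixedPt f x := by
  have hR0 : 0 ≤ R := (norm_nonneg _).trans (hR 0)
  let χ : E → ℝ := fun x => max 0 (min 1 (R + 1 - ‖x‖))
  have hχ : Continuous χ := by fun_prop
  have hχ0 : ∀ x, 0 ≤ χ x := fun x => le_max_left _ _
  have hχ1 : ∀ x, χ x ≤ 1 := fun x => max_le zero_le_one (min_le_left _ _)
  have hs : HasCompactSupport fun x => -(χ x • f x) := by
    refine HasCompactSupport.intro (isCompact_closedBall 0 (R + 1)) fun x hx => ?_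
    rw [mem_closedBall_zero_iff, not_le] at hx
    have : χ x = 0 := max_eq_left ((min_le_right _ _).trans (by linarith))
    simp [this]
  obtain ⟨x, hx⟩ := Continuous.exists_add_eq_zero (hχ.smul hf).neg hs
  have hfx : x = χ x • f x := add_neg_eq_zero.1 hx
  have hxR : ‖x‖ ≤ R := by
    rw [hfx, norm_smul, Real.norm_of_nonneg (hχ0 x)]
    exact (mul_le_of_le_one_left (norm_nonneg _) (hχ1 x)).trans (hR x)
  have : χ x = 1 := by
    simp only [χ]
    rw [min_eq_left (by linarith), max_eq_right zero_le_one]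
  rw [this, one_smul] at hfx
  exact ⟨x, hfx.symm⟩

end FixedPoint

/-- **Brouwer's fixed point theorem** for the unit cube. -/
theorem ContinuousOn.exists_isFixedPt_unitCube {ι : Type*} [Fintype ι] {f : (ι → ℝ) → ι → ℝ}
    (hf : ContinuousOn f (Icc 0 1)) (hmaps : MapsTo f (Icc 0 1) (Icc 0 1)) :
    ∃ x ∈ Icc 0 1, Function.IsFixedPt f x := by
  let clamp : (ι → ℝ) → ι → ℝ := fun x i => max 0 (min 1 (x i))
  have hclamp : Continuous clamp := by fun_prop
  have hmem : ∀ x, clamp x ∈ Icc (0 : ι → ℝ) 1 := fun x =>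
    ⟨fun i => le_max_left _ _, fun i => max_le zero_le_one (min_le_left _ _)⟩
  let F : EuclideanSpace ℝ ι → EuclideanSpace ℝ ι := fun x => WithLp.toLp 2 (f (clamp x.ofLp))
  have hfc : Continuous fun x => f (clamp x) :=
    hf.comp_continuous hclamp hmem
  have hF : Continuous F :=
    (PiLp.continuous_toLp 2 _).comp (hfc.comp (PiLp.continuous_ofLp 2 _))
  obtain ⟨R, hR⟩ := (isCompact_Icc (a := (0 : ι → ℝ)) (b := 1)).exists_bound_of_continuousOn
    ((PiLp.continuous_toLp 2 fun _ : ι => ℝ).comp_continuousOn hf)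
  obtain ⟨x, hx⟩ := hF.exists_isFixedPt_of_norm_le fun x => hR _ (hmem x.ofLp)
  have hfx : f (clamp x.ofLp) = x.ofLp := congrArg WithLp.ofLp hx
  have hxm : x.ofLp ∈ Icc (0 : ι → ℝ) 1 := hfx ▸ hmaps (hmem _)
  have hcx : clamp x.ofLp = x.ofLp := by
    ext i
    have h0 : 0 ≤ x.ofLp i := hxm.1 i
    have h1 : x.ofLp i ≤ 1 := hxm.2 i
    simp [clamp, h0, h1]
  rw [hcx] at hfx
  exact ⟨x.ofLp, hxm, hfx⟩

/-- A convex function on a set of reals lies above its tangent lines. -/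
lemma ConvexOn.sub_le_deriv_mul_sub {f : ℝ → ℝ} {S : Set ℝ} (hf : ConvexOn ℝ S f) {f' x y : ℝ}
    (hx : x ∈ S) (hy : y ∈ S) (hd : HasDerivAt f f' x) : f x - f y ≤ f' * (x - y) := by
  rcases lt_trichotomy x y with h | rfl | h
  · have := hf.le_slope_of_hasDerivAt hx hy h hd
    rw [slope_def_field, le_div_iff₀ (sub_pos.2 h)] at this
    linarith
  · simp
  · have := hf.slope_le_of_hasDerivAt hy hx h hd
    rwa [slope_def_field, div_le_iff₀ (sub_pos.2 h)] at this

end Brouwer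


/-- Existence of an ROI-optimal pure Nash equilibrium in uniform scaling
strategies for a multi-agent mechanism `(A, P)` that is truthful for quasi-linear buyers,
under continuity of the induced value/payment maps on `[0,1]^n` and strict monotonicity of
each agent's payment in her own scaling factor. There is a profile `α ∈ (0,1]^n` such that
each bid `α_i • v_i` maximizes agent `i`'s utility against the others' scaled bids, and
`α_i · C_i'(p_i(α·v)) = 1` for every `i`. -/
theorem stmt5 {X : Type*} [Nonempty X] (n : ℕ) (V : Set (X → ℝ))
    (hVpos : ∀ w ∈ V, ∀ x : X, 0 ≤ w x)
    (hVscale : ∀ c : ℝ, 0 ≤ c → ∀ w ∈ V, c • w ∈ V)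
    (A : (Fin n → (X → ℝ)) → X) (P : (Fin n → (X → ℝ)) → Fin n → ℝ)
    (hPpos : ∀ b : Fin n → (X → ℝ), (∀ j, b j ∈ V) → ∀ i, 0 ≤ P b i)
    (htruthful : ∀ b : Fin n → (X → ℝ), (∀ j, b j ∈ V) → ∀ i : Fin n, ∀ w ∈ V,
      w (A (Function.update b i w)) - P (Function.update b i w) i ≥ w (A b) - P b i)
    (v : Fin n → (X → ℝ)) (hvV : ∀ i, v i ∈ V) (hv1 : ∀ i (x : X), v i x ≤ 1)
    (C C' : Fin n → ℝ → ℝ)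
    (hCconv : ∀ i, ConvexOn ℝ (Set.Ici 0) (C i))
    (hCmono : ∀ i, StrictMonoOn (C i) (Set.Ici 0))
    (hCderiv : ∀ i, ∀ p : ℝ, 0 ≤ p → HasDerivAt (C i) (C' i p) p)
    (hC'cont : ∀ i, ContinuousOn (C' i) (Set.Ici 0))
    (hC0 : ∀ i, C i 0 = 0)
    (hC'1 : ∀ i, ∀ p : ℝ, 0 ≤ p → 1 ≤ C' i p)
    (hVcont : ∀ i, ContinuousOn
      (fun α : Fin n → ℝ => v i (A fun j => α j • v j)) (Set.Icc 0 1))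
    (hPcont : ∀ i, ContinuousOn
      (fun α : Fin n → ℝ => P (fun j => α j • v j) i) (Set.Icc 0 1))
    (hPinc : ∀ i : Fin n, ∀ α : Fin n → ℝ, (∀ j, α j ∈ Set.Icc (0 : ℝ) 1) →
      StrictMonoOn
        (fun t : ℝ => P (Function.update (fun j => α j • v j) i (t • v i)) i)
        (Set.Icc 0 1)) :
    ∃ α : Fin n → ℝ, (∀ i, α i ∈ Set.Ioc (0 : ℝ) 1) ∧
      ∀ i : Fin n,
        (∀ b' ∈ V,
          v i (A fun j => α j • v j) - C i (P (fun j => α j • v j) i) ≥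
            v i (A (Function.update (fun j => α j • v j) i b')) -
              C i (P (Function.update (fun j => α j • v j) i b') i)) ∧
        α i * C' i (P (fun j => α j • v j) i) = 1 := by
  have hcpos : ∀ α ∈ Set.Icc (0 : Fin n → ℝ) 1, ∀ i,
      0 ≤ P (fun j => α j • v j) i := fun α hα i =>
    hPpos _ (fun j => hVscale _ (hα.1 j) _ (hvV j)) i
  have hC'pos : ∀ α ∈ Set.Icc (0 : Fin n → ℝ) 1, ∀ i,
      1 ≤ C' i (P (fun j => α j • v j) i) := fun α hα i => hC'1 i _ (hcpos α hα i)
  have hcont : ContinuousOn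
      (fun (α : Fin n → ℝ) i => (C' i (P (fun j => α j • v j) i))⁻¹) (Set.Icc 0 1) :=
    continuousOn_pi.2 fun i => ((hC'cont i).comp (hPcont i) fun α hα => hcpos α hα i).inv₀
      fun α hα => (zero_lt_one.trans_le (hC'pos α hα i)).ne'
  obtain ⟨α, hα, hfix⟩ := hcont.exists_isFixedPt_unitCube fun α hα =>
    ⟨fun i => inv_nonneg.2 (zero_le_one.trans (hC'pos α hα i)),
      fun i => inv_le_one_of_one_le₀ (hC'pos α hα i)⟩
  have hαi : ∀ i, (C' i (P (fun j => α j • v j) i))⁻¹ = α i := fun i => congrFun hfix i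
  have hC'i : ∀ i, 0 < C' i (P (fun j => α j • v j) i) := fun i =>
    zero_lt_one.trans_le (hC'pos α hα i)
  refine ⟨α, fun i => ⟨hαi i ▸ inv_pos.2 (hC'i i), hα.2 i⟩, fun i => ?_⟩
  have hroi : α i * C' i (P (fun j => α j • v j) i) = 1 := by
    rw [← hαi i]
    exact inv_mul_cancel₀ (hC'i i).ne'
  refine ⟨fun b' hb' => ?_, hroi⟩
  have hbV : ∀ j, α j • v j ∈ V := fun j => hVscale _ (hα.1 j) _ (hvV j)
  have hb'V : ∀ j, Function.update (fun j => α j • v j) i b' j ∈ V := by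
    intro j
    rcases eq_or_ne j i with rfl | hj
    · simpa using hb'
    · simpa [hj] using hbV j
  have htr := htruthful _ hb'V i (α i • v i) (hbV i)
  rw [Function.update_idem, Function.update_eq_self i (fun j => α j • v j)] at htr
  simp only [Pi.smul_apply, smul_eq_mul] at htr
  have htangent := (hCconv i).sub_le_deriv_mul_sub (hcpos α hα i) (hPpos _ hb'V i)
    (hCderiv i _ (hcpos α hα i))
  have hmul := mul_le_mul_of_nonneg_left htr (hC'i i).le
  set c := C' i (P (fun j => α j • v j) i)
  linear_combination hmul + htangent + (v i (A fun j => α j • v j) -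
    v i (A (Function.update (fun j => α j • v j) i b'))) * hroi
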